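/- arXiv:1304.1849 — 3 statements merged into one kernel-verified Lean document; each statement's English description precedes it below -/
import Mathlib

section
/- For every M ≥ 1, T > 0 and integer η ≥ 2 there exists a constant C > 0, depending only on M, T and η, such that for all admissible parameters (α, θ, ℓ), every t ∈ (0, T] and every x ∈ ℝ, one has (𝒞_θ^η Γ^{α,θ,ℓ}(t,·))(x) ≤ C · (𝒞_{2ηθ} Γ^{α, 2ηθ, ℓ}(t,·))(x). -/
open Real MeasureTheory

/-- Gaussian density component `Γ_n^{α,θ,ℓ}(t,x)`. -/
noncomputable def Gn (α θ l : ℝ) (n : ℕ) (t x : ℝ) : ℝ :=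
  (Real.sqrt (2 * Real.pi * (α * t + (n : ℝ) * θ)))⁻¹ *
    Real.exp (-(x - (α / 2 + l * (Real.exp (θ / 2) - 1)) * t) ^ 2 / (2 * (α * t + (n : ℝ) * θ)))

/-- Compound-Poisson jump-diffusion density `Γ^{α,θ,ℓ}(t,x)`. -/
noncomputable def G (α θ l : ℝ) (t x : ℝ) : ℝ :=
  Real.exp (-(l * t)) * ∑' n : ℕ, (l * t) ^ n / (Nat.factorial n : ℝ) * Gn α θ l n t x

/-- Centered Gaussian density component `Γ̄_n^{α,θ}(t,x)`. -/
noncomputable def GBn (α θ : ℝ) (n : ℕ) (t x : ℝ) : ℝ :=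
  (Real.sqrt (2 * Real.pi * (α * t + (n : ℝ) * θ)))⁻¹ *
    Real.exp (-x ^ 2 / (2 * (α * t + (n : ℝ) * θ)))

/-- Centered jump-diffusion density `Γ̄^{α,θ,ℓ}(t,x)`. -/
noncomputable def GB (α θ l : ℝ) (t x : ℝ) : ℝ :=
  Real.exp (-(l * t)) * ∑' n : ℕ, (l * t) ^ n / (Nat.factorial n : ℝ) * GBn α θ n t x

/-- Gaussian convolution operator `𝒞_θ`. -/
noncomputable def conv (θ : ℝ) (f : ℝ → ℝ) (x : ℝ) : ℝ :=
  ∫ z : ℝ, f (x + z) * ((Real.sqrt (2 * Real.pi * θ))⁻¹ * Real.exp (-z ^ 2 / (2 * θ)))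

/-- The centered Gaussian density of variance `s`. -/
noncomputable def gaussDensity (s u : ℝ) : ℝ :=
  (Real.sqrt (2 * Real.pi * s))⁻¹ * Real.exp (-u ^ 2 / (2 * s))

/-- The mixture, with weights `a n`, of Gaussian densities of variance `s n` and common mean `m`. -/
noncomputable def gaussMixture (a s : ℕ → ℝ) (m x : ℝ) : ℝ :=
  ∑' n, a n * gaussDensity (s n) (x - m)

lemma gaussDensity_nonneg (s u : ℝ) : 0 ≤ gaussDensity s u := by
  unfold gaussDensity; positivity

lemma gaussDensity_le {r s : ℝ} (hr : 0 < r) (hrs : r ≤ s) (u : ℝ) :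
    gaussDensity s u ≤ (Real.sqrt (2 * Real.pi * r))⁻¹ := by
  have hs : 0 < s := hr.trans_le hrs
  have hexp : Real.exp (-u ^ 2 / (2 * s)) ≤ 1 :=
    Real.exp_le_one_iff.mpr (div_nonpos_of_nonpos_of_nonneg (by nlinarith [sq_nonneg u]) (by positivity))
  calc gaussDensity s u ≤ (Real.sqrt (2 * Real.pi * s))⁻¹ * 1 := by
        unfold gaussDensity; gcongr
    _ ≤ _ := by rw [mul_one]; gcongr

lemma gaussDensity_mul {s r : ℝ} (hs : 0 < s) (hr : 0 < r) (u z : ℝ) :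
    gaussDensity s (u + z) * gaussDensity r z =
      (Real.sqrt (2 * Real.pi * s))⁻¹ * (Real.sqrt (2 * Real.pi * r))⁻¹ *
        Real.exp (-u ^ 2 / (2 * (s + r))) *
        Real.exp (-((s + r) / (2 * s * r)) * (z + u * r / (s + r)) ^ 2) := by
  have hexp : Real.exp (-(u + z) ^ 2 / (2 * s)) * Real.exp (-z ^ 2 / (2 * r)) =
      Real.exp (-u ^ 2 / (2 * (s + r))) *
        Real.exp (-((s + r) / (2 * s * r)) * (z + u * r / (s + r)) ^ 2) := by
    rw [← Real.exp_add, ← Real.exp_add]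
    congr 1
    have : s + r ≠ 0 := by positivity
    field_simp
    ring
  unfold gaussDensity
  linear_combination (Real.sqrt (2 * Real.pi * s))⁻¹ * (Real.sqrt (2 * Real.pi * r))⁻¹ * hexp

lemma integrable_gaussDensity_mul {s r : ℝ} (hs : 0 < s) (hr : 0 < r) (u : ℝ) :
    Integrable fun z => gaussDensity s (u + z) * gaussDensity r z := by
  simp_rw [gaussDensity_mul hs hr]
  have hb : 0 < (s + r) / (2 * s * r) := by positivity
  exact ((integrable_exp_neg_mul_sq hb).comp_add_right (u * r / (s + r))).const_mul _

lemma integral_gaussDensity_mul {s r : ℝ} (hs : 0 < s) (hr : 0 < r) (u : ℝ) :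
    ∫ z, gaussDensity s (u + z) * gaussDensity r z = gaussDensity (s + r) u := by
  simp_rw [gaussDensity_mul hs hr]
  rw [integral_const_mul, integral_add_right_eq_self
    (fun z => Real.exp (-((s + r) / (2 * s * r)) * z ^ 2)), integral_gaussian]
  have hsqrt : (Real.sqrt (2 * Real.pi * s))⁻¹ * (Real.sqrt (2 * Real.pi * r))⁻¹ *
      Real.sqrt (Real.pi / ((s + r) / (2 * s * r))) = (Real.sqrt (2 * Real.pi * (s + r)))⁻¹ := by
    rw [← Real.sqrt_inv, ← Real.sqrt_inv, ← Real.sqrt_inv, ← Real.sqrt_mul (by positivity),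
      ← Real.sqrt_mul (by positivity)]
    congr 1
    have : s + r ≠ 0 := by positivity
    field_simp
  unfold gaussDensity
  linear_combination Real.exp (-u ^ 2 / (2 * (s + r))) * hsqrt

lemma summable_gaussMixture {a s : ℕ → ℝ} {r : ℝ} (ha : ∀ n, 0 ≤ a n) (hsum : Summable a)
    (hr : 0 < r) (hs : ∀ n, r ≤ s n) (u : ℝ) :
    Summable fun n => a n * gaussDensity (s n) u :=
  Summable.of_nonneg_of_le (fun n => mul_nonneg (ha n) (gaussDensity_nonneg _ _))
    (fun n => mul_le_mul_of_nonneg_left (gaussDensity_le hr (hs n) u) (ha n))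
    (hsum.mul_right _)

lemma conv_gaussMixture {a s : ℕ → ℝ} {r : ℝ} (ha : ∀ n, 0 ≤ a n) (hsum : Summable a)
    (hs : ∀ n, 0 < s n) (hr : 0 < r) (m : ℝ) :
    conv r (gaussMixture a s m) = gaussMixture a (fun n => s n + r) m := by
  funext x
  have hint : ∀ n, ∫ z, a n * (gaussDensity (s n) (x - m + z) * gaussDensity r z) =
      a n * gaussDensity (s n + r) (x - m) := fun n => by
    rw [integral_const_mul, integral_gaussDensity_mul (hs n) hr]
  have hnorm : ∀ n z, ‖a n * (gaussDensity (s n) (x - m + z) * gaussDensity r z)‖ =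
      a n * (gaussDensity (s n) (x - m + z) * gaussDensity r z) := fun n z =>
    Real.norm_of_nonneg
      (mul_nonneg (ha n) (mul_nonneg (gaussDensity_nonneg _ _) (gaussDensity_nonneg _ _)))
  have key := hasSum_integral_of_summable_integral_norm
    (F := fun n z => a n * (gaussDensity (s n) (x - m + z) * gaussDensity r z)) (μ := volume)
    (fun n => (integrable_gaussDensity_mul (hs n) hr _).const_mul _)
    (by
      simp_rw [hnorm, hint]
      exact summable_gaussMixture ha hsum hr (fun n => le_add_of_nonneg_left (hs n).le) _)
  simp_rw [hint] at key
  refine Eq.trans ?_ key.tsum_eq.symm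
  refine integral_congr_ae (Filter.Eventually.of_forall fun z => ?_)
  change gaussMixture a s m (x + z) * gaussDensity r z = _
  simp only [gaussMixture, ← mul_assoc, tsum_mul_right, add_sub_right_comm]

lemma conv_iterate_gaussMixture {a s : ℕ → ℝ} {r : ℝ} (ha : ∀ n, 0 ≤ a n) (hsum : Summable a)
    (hs : ∀ n, 0 < s n) (hr : 0 < r) (m : ℝ) (k : ℕ) :
    (conv r)^[k] (gaussMixture a s m) = gaussMixture a (fun n => s n + k * r) m := by
  induction k with
  | zero => simp
  | succ k ih =>
    rw [Function.iterate_succ_apply', ih, conv_gaussMixture ha hsum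
      (fun n => add_pos_of_pos_of_nonneg (hs n) (by positivity)) hr]
    congr 1
    funext n
    push_cast
    ring

lemma G_eq_gaussMixture (α θ l t : ℝ) :
    G α θ l t = gaussMixture (fun n => Real.exp (-(l * t)) * ((l * t) ^ n / (Nat.factorial n : ℝ)))
      (fun n => α * t + n * θ) ((α / 2 + l * (Real.exp (θ / 2) - 1)) * t) := by
  funext x
  simp only [G, gaussMixture, mul_assoc (Real.exp _), tsum_mul_left]
  rfl

/-- A Gaussian density is dominated by a shifted one of strictly larger variance. -/
lemma gaussDensity_le_mul_shift {s v K ε r D d : ℝ} (hs : 0 < s) (hε : 0 < ε) (hr : 0 < r)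
    (hsv : (1 + ε) * s ≤ v) (hvK : v ≤ K * s) (hrv : r ≤ v) (hd : |d| ≤ D) (u : ℝ) :
    gaussDensity s u ≤
      Real.sqrt K * Real.exp ((1 + ε⁻¹) * D ^ 2 / (2 * r)) * gaussDensity v (u - d) := by
  have hv : 0 < v := hr.trans_le hrv
  have hK : 0 ≤ K := by
    by_contra! h
    nlinarith
  have hd2 : d ^ 2 ≤ D ^ 2 := sq_le_sq' (abs_le.mp hd).1 (abs_le.mp hd).2
  have hsqrt : (Real.sqrt (2 * Real.pi * s))⁻¹ ≤
      Real.sqrt K * (Real.sqrt (2 * Real.pi * v))⁻¹ := by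
    rw [← div_eq_mul_inv, le_div_iff₀ (by positivity), inv_mul_le_iff₀ (by positivity),
      ← Real.sqrt_mul (by positivity)]
    exact Real.sqrt_le_sqrt (by nlinarith [Real.pi_pos])
  have hyoung : (u - d) ^ 2 ≤ (1 + ε) * u ^ 2 + (1 + ε⁻¹) * d ^ 2 := by
    have h : (1 + ε) * u ^ 2 + (1 + ε⁻¹) * d ^ 2 - (u - d) ^ 2 = ε⁻¹ * (ε * u + d) ^ 2 := by
      field_simp
      ring
    have : 0 ≤ ε⁻¹ * (ε * u + d) ^ 2 := by positivity
    linarith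
  have hquad : (u - d) ^ 2 / (2 * v) ≤ u ^ 2 / (2 * s) + (1 + ε⁻¹) * D ^ 2 / (2 * r) := by
    calc (u - d) ^ 2 / (2 * v)
        ≤ ((1 + ε) * u ^ 2 + (1 + ε⁻¹) * d ^ 2) / (2 * v) := by gcongr
      _ = (1 + ε) * u ^ 2 / (2 * v) + (1 + ε⁻¹) * d ^ 2 / (2 * v) := add_div _ _ _
      _ ≤ u ^ 2 / (2 * s) + (1 + ε⁻¹) * D ^ 2 / (2 * r) := by
        gcongr ?_ + ?_
        · rw [div_le_div_iff₀ (by positivity) (by positivity)]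
          nlinarith [sq_nonneg u]
        · gcongr
  have hexp : Real.exp (-u ^ 2 / (2 * s)) ≤
      Real.exp ((1 + ε⁻¹) * D ^ 2 / (2 * r)) * Real.exp (-(u - d) ^ 2 / (2 * v)) := by
    rw [← Real.exp_add, Real.exp_le_exp, neg_div, neg_div]
    linarith
  calc gaussDensity s u
      ≤ (Real.sqrt K * (Real.sqrt (2 * Real.pi * v))⁻¹) *
        (Real.exp ((1 + ε⁻¹) * D ^ 2 / (2 * r)) * Real.exp (-(u - d) ^ 2 / (2 * v))) := by
        unfold gaussDensity; gcongr
    _ = _ := by unfold gaussDensity; ring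

/-- Lemma 5.10: `𝒞_θ^η Γ^{α,θ,ℓ}(t,x) ≤ C 𝒞_{2ηθ} Γ^{α,2ηθ,ℓ}(t,x)` for `η ≥ 2`. -/
theorem stmt3 (M T : ℝ) (η : ℕ) (hM : 1 ≤ M) (hT : 0 < T) (hη : 2 ≤ η) :
    ∃ C : ℝ, 0 < C ∧
      ∀ α θ l : ℝ, M⁻¹ ≤ α → α ≤ M → M⁻¹ ≤ θ → θ ≤ M → 0 ≤ l → l ≤ M →
        ∀ t ∈ Set.Ioc (0 : ℝ) T, ∀ x : ℝ,
          (conv θ)^[η] (G α θ l t) x ≤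
            C * conv (2 * (η : ℝ) * θ) (G α (2 * (η : ℝ) * θ) l t) x := by
  have hM0 : 0 < M := zero_lt_one.trans_le hM
  have hη' : (2 : ℝ) ≤ η := by exact_mod_cast hη
  set D : ℝ := M * T * Real.exp (η * M) with hD
  set ε : ℝ := (1 + M ^ 2 * T)⁻¹ with hε
  have hε0 : 0 < ε := by positivity
  have hε1 : ε + ε * (M ^ 2 * T) = 1 := by
    rw [hε]
    field_simp
  refine ⟨Real.sqrt (2 * η) * Real.exp ((1 + ε⁻¹) * D ^ 2 / (2 * M⁻¹)), by positivity, ?_⟩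
  rintro α θ l hα hαM hθ hθM hl hlM t ⟨ht, htT⟩ x
  have hMinv : 0 < M⁻¹ := inv_pos.mpr hM0
  have hα0 : 0 < α := hMinv.trans_le hα
  have hθ0 : 0 < θ := hMinv.trans_le hθ
  have hαt : 0 < α * t := mul_pos hα0 ht
  have hlt : 0 ≤ l * t := mul_nonneg hl ht.le
  have hΘ : 0 < 2 * (η : ℝ) * θ := by positivity
  have hΘθ : θ ≤ 2 * (η : ℝ) * θ := by nlinarith
  have ha : ∀ n : ℕ, 0 ≤ Real.exp (-(l * t)) * ((l * t) ^ n / (Nat.factorial n : ℝ)) :=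
    fun n => by positivity
  have hsum : Summable fun n : ℕ => Real.exp (-(l * t)) * ((l * t) ^ n / (Nat.factorial n : ℝ)) :=
    (Real.summable_pow_div_factorial _).mul_left _
  rw [G_eq_gaussMixture, G_eq_gaussMixture,
    conv_iterate_gaussMixture ha hsum (fun n => by positivity) hθ0,
    conv_gaussMixture ha hsum (fun n => by positivity) hΘ]
  unfold gaussMixture
  rw [← tsum_mul_left]
  refine Summable.tsum_le_tsum (fun n => ?_)
    (summable_gaussMixture ha hsum (mul_pos (by positivity : (0 : ℝ) < η) hθ0)
      (fun n => le_add_of_nonneg_left (by positivity)) _)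
    ((summable_gaussMixture ha hsum hΘ
      (fun n => le_add_of_nonneg_left (by positivity)) _).mul_left _)
  rw [mul_left_comm]
  refine mul_le_mul_of_nonneg_left ?_ (ha n)
  have hn : (0 : ℝ) ≤ n := n.cast_nonneg
  have hd : |l * t * (Real.exp (2 * η * θ / 2) - Real.exp (θ / 2))| ≤ D := by
    have h₁ : Real.exp (θ / 2) ≤ Real.exp (2 * η * θ / 2) := Real.exp_le_exp.mpr (by linarith)
    have h₂ : Real.exp (2 * η * θ / 2) ≤ Real.exp (η * M) := Real.exp_le_exp.mpr (by nlinarith)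
    have h₃ := Real.exp_pos (θ / 2)
    rw [abs_of_nonneg (mul_nonneg hlt (sub_nonneg.mpr h₁)), hD]
    exact mul_le_mul (mul_le_mul hlM htT ht.le hM0.le) (by linarith) (sub_nonneg.mpr h₁)
      (by positivity)
  have hnη : (n + η) * θ ≤ (n + 1) * (η * θ) := by nlinarith [mul_nonneg hn hθ0.le]
  have hαtM : α * t ≤ M * T := mul_le_mul hαM htT ht.le hM0.le
  have hMθ : 1 ≤ M * ((n + η) * θ) := by
    have h₁ : 1 ≤ M * θ := by
      calc 1 = M * M⁻¹ := (mul_inv_cancel₀ hM0.ne').symm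
        _ ≤ M * θ := by gcongr
    nlinarith
  have hgap : (1 + ε) * (α * t + n * θ + η * θ) ≤ α * t + n * (2 * η * θ) + 2 * η * θ := by
    have h₁ : ε * (α * t) ≤ ε * (M ^ 2 * T) * ((n + η) * θ) := by
      calc ε * (α * t) ≤ ε * (M * T) := by gcongr
        _ ≤ ε * (M * T) * (M * ((n + η) * θ)) := le_mul_of_one_le_right (by positivity) hMθ
        _ = _ := by ring
    have h₂ : (n + η) * θ = (ε + ε * (M ^ 2 * T)) * ((n + η) * θ) := by rw [hε1, one_mul]
    linarith
  have hratio : α * t + n * (2 * η * θ) + 2 * η * θ ≤ 2 * η * (α * t + n * θ + η * θ) := by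
    have h₁ : α * t ≤ 2 * η * (α * t) := by nlinarith
    have h₂ : 2 * η * θ ≤ 2 * η * (η * θ) := by
      have : θ ≤ η * θ := by nlinarith
      gcongr
    linarith
  have hshift : x - (α / 2 + l * (Real.exp (2 * η * θ / 2) - 1)) * t =
      x - (α / 2 + l * (Real.exp (θ / 2) - 1)) * t -
        l * t * (Real.exp (2 * η * θ / 2) - Real.exp (θ / 2)) := by ring
  rw [hshift]
  exact gaussDensity_le_mul_shift (by positivity) hε0 hMinv hgap hratio
    (by nlinarith [mul_nonneg hn hΘ.le]) hd _
end

section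
/- For all real α, θ > 0 and ℓ ≥ 0, all integers η ≥ 1 and k ≥ 1, every t > 0 and every x ∈ ℝ, one has (𝒞_θ^η Γ̄^{α,θ,ℓ}(t,·))(x) ≤ √(k+1) · (𝒞_θ^{η+k} Γ̄^{α,θ,ℓ}(t,·))(x). -/
open Real MeasureTheory

/-- The Gaussian convolution integrand is, up to a constant, a shifted Gaussian. -/
lemma gaussian_mul_eq_shifted {v θ : ℝ} (hv : 0 < v) (hθ : 0 < θ) (x z : ℝ) :
    (√(2 * π * v))⁻¹ * exp (-(x + z) ^ 2 / (2 * v)) * ((√(2 * π * θ))⁻¹ * exp (-z ^ 2 / (2 * θ))) =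
      (√(2 * π * v))⁻¹ * (√(2 * π * θ))⁻¹ * exp (-x ^ 2 / (2 * (v + θ))) *
        exp (-((v + θ) / (2 * v * θ)) * (z + x * θ / (v + θ)) ^ 2) := by
  have hvθ : v + θ ≠ 0 := by positivity
  have h : exp (-(x + z) ^ 2 / (2 * v)) * exp (-z ^ 2 / (2 * θ)) =
      exp (-x ^ 2 / (2 * (v + θ))) *
        exp (-((v + θ) / (2 * v * θ)) * (z + x * θ / (v + θ)) ^ 2) := by
    rw [← exp_add, ← exp_add]
    congr 1
    field_simp
    ring
  linear_combination (√(2 * π * v))⁻¹ * (√(2 * π * θ))⁻¹ * h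

lemma integrable_gaussian_mul {v θ : ℝ} (hv : 0 < v) (hθ : 0 < θ) (x : ℝ) :
    Integrable fun z : ℝ ↦ (√(2 * π * v))⁻¹ * exp (-(x + z) ^ 2 / (2 * v)) *
      ((√(2 * π * θ))⁻¹ * exp (-z ^ 2 / (2 * θ))) := by
  simp_rw [gaussian_mul_eq_shifted hv hθ]
  have hb : 0 < (v + θ) / (2 * v * θ) := by positivity
  exact ((integrable_exp_neg_mul_sq hb).comp_add_right (x * θ / (v + θ))).const_mul _

/-- The convolution of centered Gaussian densities adds their variances. -/
lemma conv_gaussian {v θ : ℝ} (hv : 0 < v) (hθ : 0 < θ) (x : ℝ) :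
    conv θ (fun y ↦ (√(2 * π * v))⁻¹ * exp (-y ^ 2 / (2 * v))) x =
      (√(2 * π * (v + θ)))⁻¹ * exp (-x ^ 2 / (2 * (v + θ))) := by
  unfold conv
  simp_rw [gaussian_mul_eq_shifted hv hθ]
  rw [integral_const_mul,
    integral_add_right_eq_self (fun z : ℝ ↦ exp (-((v + θ) / (2 * v * θ)) * z ^ 2)),
    integral_gaussian]
  have h : (√(2 * π * v))⁻¹ * (√(2 * π * θ))⁻¹ * √(π / ((v + θ) / (2 * v * θ))) =
      (√(2 * π * (v + θ)))⁻¹ := by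
    rw [← sqrt_inv, ← sqrt_inv, ← sqrt_inv, ← sqrt_mul (by positivity),
      ← sqrt_mul (by positivity)]
    congr 1
    field_simp
  linear_combination exp (-x ^ 2 / (2 * (v + θ))) * h

lemma GBn_nonneg (α θ : ℝ) (n : ℕ) (t x : ℝ) : 0 ≤ GBn α θ n t x := by
  unfold GBn
  positivity

lemma integrable_GBn_mul {α θ t : ℝ} (hα : 0 < α) (hθ : 0 < θ) (ht : 0 < t) (n : ℕ) (x : ℝ) :
    Integrable fun z : ℝ ↦
      GBn α θ n t (x + z) * ((√(2 * π * θ))⁻¹ * exp (-z ^ 2 / (2 * θ))) :=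
  integrable_gaussian_mul (v := α * t + n * θ) (by positivity) hθ x

lemma conv_GBn {α θ t : ℝ} (hα : 0 < α) (hθ : 0 < θ) (ht : 0 < t) (n : ℕ) (x : ℝ) :
    conv θ (GBn α θ n t) x = GBn α θ (n + 1) t x := by
  have h := conv_gaussian (v := α * t + n * θ) (by positivity) hθ x
  have e : α * t + n * θ + θ = α * t + ((n + 1 : ℕ) : ℝ) * θ := by
    push_cast
    ring
  rwa [e] at h

lemma GBn_le {α θ t : ℝ} (hα : 0 < α) (hθ : 0 < θ) (ht : 0 < t) (n : ℕ) (x : ℝ) :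
    GBn α θ n t x ≤ (√(2 * π * (α * t)))⁻¹ := by
  have h1 : exp (-x ^ 2 / (2 * (α * t + n * θ))) ≤ 1 :=
    exp_le_one_iff.2 (div_nonpos_of_nonpos_of_nonneg (by nlinarith [sq_nonneg x]) (by positivity))
  have h2 : (√(2 * π * (α * t + n * θ)))⁻¹ ≤ (√(2 * π * (α * t)))⁻¹ := by
    gcongr
    exact le_add_of_nonneg_right (by positivity)
  calc GBn α θ n t x ≤ (√(2 * π * (α * t + n * θ)))⁻¹ * 1 := by unfold GBn; gcongr
    _ ≤ _ := by rwa [mul_one]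

lemma summable_GBn {α θ l t : ℝ} (hα : 0 < α) (hθ : 0 < θ) (hl : 0 ≤ l) (ht : 0 < t)
    (m : ℕ) (x : ℝ) :
    Summable fun n : ℕ ↦ (l * t) ^ n / (n.factorial : ℝ) * GBn α θ (n + m) t x := by
  refine Summable.of_nonneg_of_le
    (fun n ↦ mul_nonneg (by positivity) (GBn_nonneg _ _ _ _ _))
    (fun n ↦ mul_le_mul_of_nonneg_left (GBn_le hα hθ ht _ x) (by positivity))
    ((Real.summable_pow_div_factorial (l * t)).mul_right _)

/-- Each application of the convolution operator shifts the variance index of the Poisson mixture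
by one. -/
lemma iterate_conv_GB {α θ l t : ℝ} (hα : 0 < α) (hθ : 0 < θ) (hl : 0 ≤ l) (ht : 0 < t) (m : ℕ) :
    (conv θ)^[m] (GB α θ l t) = fun x ↦
      exp (-(l * t)) * ∑' n : ℕ, (l * t) ^ n / (n.factorial : ℝ) * GBn α θ (n + m) t x := by
  induction m with
  | zero => rfl
  | succ m ih =>
    rw [Function.iterate_succ_apply', ih]
    funext x
    let F : ℕ → ℝ → ℝ := fun n z ↦ (l * t) ^ n / (n.factorial : ℝ) *
      (GBn α θ (n + m) t (x + z) * ((√(2 * π * θ))⁻¹ * exp (-z ^ 2 / (2 * θ))))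
    have hF_int (n : ℕ) : Integrable (F n) := (integrable_GBn_mul hα hθ ht (n + m) x).const_mul _
    have hF (n : ℕ) : ∫ z, F n z =
        (l * t) ^ n / (n.factorial : ℝ) * GBn α θ (n + (m + 1)) t x := by
      rw [integral_const_mul, ← add_assoc, ← conv_GBn hα hθ ht]
      rfl
    have hF_norm (n : ℕ) (z : ℝ) : ‖F n z‖ = F n z := by
      have := GBn_nonneg α θ (n + m) t (x + z)
      exact norm_of_nonneg (by positivity)
    have hsum := hasSum_integral_of_summable_integral_norm hF_int (by
      simpa only [hF_norm, hF] using summable_GBn hα hθ hl ht (m + 1) x)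
    simp_rw [hF] at hsum
    rw [hsum.tsum_eq, ← integral_const_mul]
    refine integral_congr_ae (.of_forall fun z ↦ ?_)
    simp only [F, ← mul_assoc, tsum_mul_right]

lemma GBn_le_sqrt_mul_GBn {α θ t : ℝ} (hα : 0 < α) (hθ : 0 < θ) (ht : 0 < t) {n : ℕ}
    (hn : 1 ≤ n) (k : ℕ) (x : ℝ) :
    GBn α θ n t x ≤ √((k : ℝ) + 1) * GBn α θ (n + k) t x := by
  have hn' : (1 : ℝ) ≤ n := by exact_mod_cast hn
  have hαt : 0 < α * t := by positivity
  have hv : 0 < α * t + n * θ := by positivity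
  have hw : 0 < α * t + ((n + k : ℕ) : ℝ) * θ := by positivity
  have hle : α * t + n * θ ≤ α * t + ((n + k : ℕ) : ℝ) * θ := by gcongr; simp
  have hexp : exp (-x ^ 2 / (2 * (α * t + n * θ))) ≤
      exp (-x ^ 2 / (2 * (α * t + ((n + k : ℕ) : ℝ) * θ))) := by
    rw [exp_le_exp, neg_div, neg_div, neg_le_neg_iff]
    gcongr
  have hratio : α * t + ((n + k : ℕ) : ℝ) * θ ≤ ((k : ℝ) + 1) * (α * t + n * θ) := by
    have h1 : 0 ≤ (k : ℝ) * (α * t) := by positivity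
    have h2 : 0 ≤ (k : ℝ) * θ * (n - 1) := mul_nonneg (by positivity) (by linarith)
    push_cast
    linarith
  have hsqrt : (√(2 * π * (α * t + n * θ)))⁻¹ ≤
      √((k : ℝ) + 1) * (√(2 * π * (α * t + ((n + k : ℕ) : ℝ) * θ)))⁻¹ := by
    rw [← div_eq_mul_inv, le_div_iff₀ (by positivity), inv_mul_le_iff₀ (by positivity),
      ← sqrt_mul (by positivity)]
    refine sqrt_le_sqrt ?_
    nlinarith [mul_le_mul_of_nonneg_left hratio (by positivity : 0 ≤ 2 * π)]
  unfold GBn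
  rw [← mul_assoc]
  gcongr

/-- Lemma 5.13: `𝒞_θ^η Γ̄^{α,θ,ℓ}(t,x) ≤ √(k+1) 𝒞_θ^{η+k} Γ̄^{α,θ,ℓ}(t,x)`. -/
theorem stmt6 (α θ l : ℝ) (hα : 0 < α) (hθ : 0 < θ) (hl : 0 ≤ l)
    (η k : ℕ) (hη : 1 ≤ η) (hk : 1 ≤ k) (t : ℝ) (ht : 0 < t) (x : ℝ) :
    (conv θ)^[η] (GB α θ l t) x ≤
      Real.sqrt ((k : ℝ) + 1) * (conv θ)^[η + k] (GB α θ l t) x := by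
  rw [iterate_conv_GB hα hθ hl ht, iterate_conv_GB hα hθ hl ht]
  dsimp only
  rw [mul_left_comm, ← tsum_mul_left (a := √((k : ℝ) + 1))]
  refine mul_le_mul_of_nonneg_left (Summable.tsum_le_tsum (fun n ↦ ?_)
    (summable_GBn hα hθ hl ht η x) ((summable_GBn hα hθ hl ht (η + k) x).mul_left _)) (exp_nonneg _)
  rw [mul_left_comm, ← add_assoc]
  exact mul_le_mul_of_nonneg_left (GBn_le_sqrt_mul_GBn hα hθ ht (by lia) k x) (by positivity)
end

section
/- For all real α, θ > 0 and ℓ ≥ 0, the function Γ^{α,θ,ℓ} is smooth on (0,∞) × ℝ and solves the integro-differential Kolmogorov equation of the constant-coefficient jump-diffusion operator L^{α,θ,ℓ}: for every t > 0 and x ∈ ℝ, ∂_t Γ^{α,θ,ℓ}(t,x) = (α/2)(∂_xx − ∂_x) Γ^{α,θ,ℓ}(t,x) − ℓ(e^{θ/2} − 1) ∂_x Γ^{α,θ,ℓ}(t,x) + ℓ ∫_ℝ ( Γ^{α,θ,ℓ}(t, x+z) − Γ^{α,θ,ℓ}(t,x) ) (2πθ)^{-1/2} e^{−z²/(2θ)}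 dz. -/
open Real MeasureTheory

open scoped Nat

/-- Kernel `v^(-m-1/2) y^j exp(-y²/(2v))`; these span the partial derivatives of the heat kernel. -/
noncomputable def heatMonomial (j m : ℕ) (v y : ℝ) : ℝ :=
  (√v)⁻¹ * v⁻¹ ^ m * y ^ j * Real.exp (-y ^ 2 / (2 * v))

/-- The `s`-th derivative in `t` of the Poisson weight `(l t)^n / n!`. -/
noncomputable def poissonWeight (l : ℝ) (s n : ℕ) (t : ℝ) : ℝ :=
  n.descFactorial s * l ^ n * t ^ (n - s) / n !

/-- Terms of the series `poissonHeatSeries`. -/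
noncomputable def poissonHeatTerm (α θ l c : ℝ) (s j m n : ℕ) (p : ℝ × ℝ) : ℝ :=
  poissonWeight l s n p.1 * heatMonomial j m (α * p.1 + n * θ) (p.2 - c * p.1)

/-- A family of series, closed under partial derivatives, containing `G` up to the factor
`exp (-l t) / √(2π)`. -/
noncomputable def poissonHeatSeries (α θ l c : ℝ) (s j m : ℕ) (p : ℝ × ℝ) : ℝ :=
  ∑' n, poissonHeatTerm α θ l c s j m n p

theorem hasDerivAt_poissonWeight (l : ℝ) (s n : ℕ) (t : ℝ) :
    HasDerivAt (poissonWeight l s n) (poissonWeight l (s + 1) n t) t := by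
  have h := ((hasDerivAt_pow (n - s) t).const_mul (n.descFactorial s * l ^ n)).div_const (n ! : ℝ)
  refine h.congr_deriv ?_
  simp only [poissonWeight, Nat.descFactorial_succ, Nat.cast_mul, Nat.sub_sub]
  ring

theorem hasFDerivAt_heatMonomial_comp {E : Type*} [NormedAddCommGroup E] [NormedSpace ℝ E]
    (j m : ℕ) {v y : E → ℝ} {v' y' : E →L[ℝ] ℝ} {p : E} (hv : HasFDerivAt v v' p)
    (hy : HasFDerivAt y y' p) (hpos : 0 < v p) :
    HasFDerivAt (fun q => heatMonomial j m (v q) (y q))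
      ((-(m + 1 / 2) * heatMonomial j (m + 1) (v p) (y p)
          + 1 / 2 * heatMonomial (j + 2) (m + 2) (v p) (y p)) • v'
        + (j * heatMonomial (j - 1) m (v p) (y p)
          - heatMonomial (j + 1) (m + 1) (v p) (y p)) • y') p := by
  have hs : √(v p) ≠ 0 := (Real.sqrt_pos.2 hpos).ne'
  have hv0 := hpos.ne'
  have hP : HasDerivAt (fun v : ℝ => (√v)⁻¹ * v⁻¹ ^ m)
      (-(m + 1 / 2) * ((√(v p))⁻¹ * (v p)⁻¹ ^ (m + 1))) (v p) := by
    have h := ((Real.hasDerivAt_sqrt hv0).inv hs).mul ((hasDerivAt_inv hv0).pow m)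
    refine h.congr_deriv ?_
    have e : √(v p) ^ 2 = v p := Real.sq_sqrt hpos.le
    rcases m with _ | m
    · simp [e]
      field_simp
    · simp [e]
      field_simp
      ring
  have hE := ((hy.pow 2).neg.mul ((hasDerivAt_inv (mul_pos two_pos hpos).ne').comp_hasFDerivAt p
    (hv.const_mul 2))).exp
  have h := ((hP.comp_hasFDerivAt p hv).mul (hy.pow j)).mul hE
  have h2 : HasFDerivAt (fun q => heatMonomial j m (v q) (y q)) _ p := h
  refine h2.congr_fderiv ?_
  ext w
  simp [heatMonomial, div_eq_mul_inv]
  field_simp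
  ring

theorem hasFDerivAt_poissonHeatTerm (α θ l c : ℝ) (s j m n : ℕ) (p : ℝ × ℝ)
    (hpos : 0 < α * p.1 + n * θ) :
    HasFDerivAt (poissonHeatTerm α θ l c s j m n)
      ((poissonHeatTerm α θ l c (s + 1) j m n p
          + α * (-(m + 1 / 2) * poissonHeatTerm α θ l c s j (m + 1) n p
            + 1 / 2 * poissonHeatTerm α θ l c s (j + 2) (m + 2) n p)
          - c * (j * poissonHeatTerm α θ l c s (j - 1) m n p
            - poissonHeatTerm α θ l c s (j + 1) (m + 1) n p)) • ContinuousLinearMap.fst ℝ ℝ ℝ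
        + (j * poissonHeatTerm α θ l c s (j - 1) m n p
            - poissonHeatTerm α θ l c s (j + 1) (m + 1) n p) • ContinuousLinearMap.snd ℝ ℝ ℝ) p := by
  have h1 : HasFDerivAt (fun q : ℝ × ℝ => α * q.1 + n * θ) (α • ContinuousLinearMap.fst ℝ ℝ ℝ) p :=
    (hasFDerivAt_fst.const_mul α).add_const _
  have h2 : HasFDerivAt (fun q : ℝ × ℝ => q.2 - c * q.1)
      (ContinuousLinearMap.snd ℝ ℝ ℝ - c • ContinuousLinearMap.fst ℝ ℝ ℝ) p :=
    hasFDerivAt_snd.sub (hasFDerivAt_fst.const_mul c)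
  have h := ((hasDerivAt_poissonWeight l s n p.1).comp_hasFDerivAt p
    (hasFDerivAt_fst (𝕜 := ℝ))).mul (hasFDerivAt_heatMonomial_comp j m h1 h2 hpos)
  have h' : HasFDerivAt (poissonHeatTerm α θ l c s j m n) _ p := h
  refine h'.congr_fderiv ?_
  ext <;> simp [poissonHeatTerm] <;> ring

theorem abs_poissonWeight_le (l : ℝ) (s n : ℕ) {t b : ℝ} (hb : 1 ≤ b) (ht : |t| ≤ b) :
    |poissonWeight l s n t| ≤ s ! * ((Real.exp 1 * |l| * b) ^ n / n !) := by
  have h1 : (n.descFactorial s : ℝ) ≤ s ! * Real.exp 1 ^ n := by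
    have h := Real.pow_div_factorial_le_exp (n : ℝ) (Nat.cast_nonneg n) s
    rw [div_le_iff₀ (by positivity)] at h
    rw [← Real.exp_nat_mul, mul_one, mul_comm]
    refine le_trans ?_ h
    exact_mod_cast Nat.descFactorial_le_pow n s
  have h2 : |t| ^ (n - s) ≤ b ^ n :=
    (pow_le_pow_left₀ (abs_nonneg t) ht _).trans (pow_le_pow_right₀ hb (Nat.sub_le n s))
  have e : |poissonWeight l s n t| = n.descFactorial s * |l| ^ n * |t| ^ (n - s) / n ! := by
    simp [poissonWeight, abs_div, abs_mul, abs_pow]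
  rw [e, mul_pow, mul_pow, ← mul_div_assoc]
  refine div_le_div_of_nonneg_right ?_ (Nat.cast_nonneg _)
  calc (n.descFactorial s : ℝ) * |l| ^ n * |t| ^ (n - s)
      ≤ (s ! * Real.exp 1 ^ n) * |l| ^ n * b ^ n := by gcongr
    _ = _ := by ring

theorem abs_heatMonomial_le (j m : ℕ) {a v R y : ℝ} (ha : 0 < a) (hv : a ≤ v) (hy : |y| ≤ R) :
    |heatMonomial j m v y| ≤ (√a)⁻¹ * a⁻¹ ^ m * R ^ j := by
  have hv0 : 0 < v := ha.trans_le hv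
  have hsa : 0 < √a := Real.sqrt_pos.2 ha
  have h1 : Real.exp (-y ^ 2 / (2 * v)) ≤ 1 := by
    rw [Real.exp_le_one_iff, neg_div]
    exact neg_nonpos.2 (by positivity)
  have e : |heatMonomial j m v y| = (√v)⁻¹ * v⁻¹ ^ m * |y| ^ j * Real.exp (-y ^ 2 / (2 * v)) := by
    simp [heatMonomial, abs_mul, abs_pow, abs_of_pos hv0]
  have hR : 0 ≤ R := (abs_nonneg y).trans hy
  rw [e]
  calc _ ≤ (√a)⁻¹ * a⁻¹ ^ m * R ^ j * 1 := by gcongr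
    _ = _ := mul_one _

theorem exists_summable_bound_poissonHeatTerm {α θ : ℝ} (hα : 0 < α) (hθ : 0 < θ) (l c : ℝ)
    {a b R : ℝ} (ha : 0 < a) (s j m : ℕ) :
    ∃ u : ℕ → ℝ, Summable u ∧ ∀ n, ∀ p ∈ Set.Ioo a b ×ˢ Set.Ioo (-R) R,
      |poissonHeatTerm α θ l c s j m n p| ≤ u n := by
  let B := max 1 b
  refine ⟨fun n => s ! * ((Real.exp 1 * |l| * B) ^ n / n !) *
    ((√(α * a))⁻¹ * (α * a)⁻¹ ^ m * (R + |c| * B) ^ j),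
    ((Real.summable_pow_div_factorial _).mul_left _).mul_right _, ?_⟩
  rintro n ⟨t, x⟩ ⟨⟨hat, htb⟩, hx1, hx2⟩
  simp only at hat htb hx1 hx2
  have ht0 : 0 < t := ha.trans hat
  have htB : |t| ≤ B := by
    rw [abs_of_pos ht0]
    exact htb.le.trans (le_max_right _ _)
  rw [poissonHeatTerm, abs_mul]
  refine mul_le_mul (abs_poissonWeight_le l s n (le_max_left _ _) htB)
    (abs_heatMonomial_le j m (by positivity) ?_ ?_) (abs_nonneg _) (by positivity)
  · have : 0 ≤ (n : ℝ) * θ := by positivity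
    have : α * a ≤ α * t := by gcongr
    simp only
    linarith
  · refine (abs_sub _ _).trans ?_
    rw [abs_mul]
    have : |x| ≤ R := abs_le.2 ⟨hx1.le, hx2.le⟩
    gcongr

theorem hasSum_poissonHeatSeries {α θ : ℝ} (hα : 0 < α) (hθ : 0 < θ) (l c : ℝ) (s j m : ℕ)
    {p : ℝ × ℝ} (hp : 0 < p.1) :
    HasSum (fun n => poissonHeatTerm α θ l c s j m n p) (poissonHeatSeries α θ l c s j m p) := by
  obtain ⟨u, hu, h⟩ := exists_summable_bound_poissonHeatTerm hα hθ l c (b := p.1 + 1)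
    (R := |p.2| + 1) (half_pos hp) s j m
  refine (Summable.of_norm_bounded hu fun n => h n p ⟨⟨?_, ?_⟩, abs_lt.1 ?_⟩).hasSum <;> linarith

theorem hasFDerivAt_poissonHeatSeries {α θ : ℝ} (hα : 0 < α) (hθ : 0 < θ) (l c : ℝ) (s j m : ℕ)
    {p : ℝ × ℝ} (hp : 0 < p.1) :
    HasFDerivAt (poissonHeatSeries α θ l c s j m)
      ((poissonHeatSeries α θ l c (s + 1) j m p
          + α * (-(m + 1 / 2) * poissonHeatSeries α θ l c s j (m + 1) p
            + 1 / 2 * poissonHeatSeries α θ l c s (j + 2) (m + 2) p)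
          - c * (j * poissonHeatSeries α θ l c s (j - 1) m p
            - poissonHeatSeries α θ l c s (j + 1) (m + 1) p)) • ContinuousLinearMap.fst ℝ ℝ ℝ
        + (j * poissonHeatSeries α θ l c s (j - 1) m p
            - poissonHeatSeries α θ l c s (j + 1) (m + 1) p) • ContinuousLinearMap.snd ℝ ℝ ℝ)
      p := by
  have hS := fun s j m => hasSum_poissonHeatSeries hα hθ l c s j m hp
  have hx := ((hS s (j - 1) m).mul_left (j : ℝ)).sub (hS s (j + 1) (m + 1))
  have ht := ((hS (s + 1) j m).add ((((hS s j (m + 1)).mul_left (-((m : ℝ) + 1 / 2))).add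
    ((hS s (j + 2) (m + 2)).mul_left (1 / 2))).mul_left α)).sub (hx.mul_left c)
  have hD := (ht.smul_const (ContinuousLinearMap.fst ℝ ℝ ℝ)).add
    (hx.smul_const (ContinuousLinearMap.snd ℝ ℝ ℝ))
  rw [← hD.tsum_eq]
  have hB := fun s j m => exists_summable_bound_poissonHeatTerm hα hθ l c (b := p.1 + 1)
    (R := |p.2| + 1) (half_pos hp) s j m
  choose u hu hle using hB
  have hmem : p ∈ Set.Ioo (p.1 / 2) (p.1 + 1) ×ˢ Set.Ioo (-(|p.2| + 1)) (|p.2| + 1) :=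
    ⟨⟨by linarith, by linarith⟩, abs_lt.1 (by linarith)⟩
  have hux := ((hu s (j - 1) m).mul_left (j : ℝ)).add (hu s (j + 1) (m + 1))
  have hut := ((hu (s + 1) j m).add ((((hu s j (m + 1)).mul_left ((m : ℝ) + 1 / 2)).add
    ((hu s (j + 2) (m + 2)).mul_left (1 / 2))).mul_left |α|)).add (hux.mul_left |c|)
  refine hasFDerivAt_tsum_of_isPreconnected (hut.add hux) (isOpen_Ioo.prod isOpen_Ioo)
    (isPreconnected_Ioo.prod isPreconnected_Ioo)
    (fun n q hq => hasFDerivAt_poissonHeatTerm α θ l c s j m n q ?_) (fun n q hq => ?_) hmem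
    (hS s j m).summable hmem
  · have : 0 < q.1 := (half_pos hp).trans hq.1.1
    positivity
  · have hb := fun s j m => hle s j m n q hq
    have key : |j * poissonHeatTerm α θ l c s (j - 1) m n q
        - poissonHeatTerm α θ l c s (j + 1) (m + 1) n q|
        ≤ j * u s (j - 1) m n + u s (j + 1) (m + 1) n := by
      refine (abs_sub _ _).trans ?_
      rw [abs_mul, Nat.abs_cast]
      gcongr <;> apply hb
    refine (norm_add_le _ _).trans (add_le_add ?_ ?_)
    · rw [norm_smul]
      refine (mul_le_of_le_one_right (norm_nonneg _) (ContinuousLinearMap.norm_fst_le ℝ ℝ ℝ)).trans ?_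
      rw [Real.norm_eq_abs]
      refine (abs_sub _ _).trans (add_le_add ((abs_add_le _ _).trans (add_le_add (hb _ _ _) ?_)) ?_)
      · rw [abs_mul]
        refine mul_le_mul_of_nonneg_left ((abs_add_le _ _).trans ?_) (abs_nonneg _)
        rw [abs_mul, abs_mul, abs_neg, abs_of_pos (by positivity : (0 : ℝ) < m + 1 / 2),
          abs_of_pos (by norm_num : (0 : ℝ) < 1 / 2)]
        gcongr <;> apply hb
      · rw [abs_mul]
        gcongr
    · rw [norm_smul]
      exact (mul_le_of_le_one_right (norm_nonneg _)
        (ContinuousLinearMap.norm_snd_le ℝ ℝ ℝ)).trans key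

theorem contDiffOn_poissonHeatSeries {α θ : ℝ} (hα : 0 < α) (hθ : 0 < θ) (l c : ℝ) (s j m : ℕ) :
    ContDiffOn ℝ (⊤ : ℕ∞) (poissonHeatSeries α θ l c s j m)
      (Set.Ioi (0 : ℝ) ×ˢ (Set.univ : Set ℝ)) := by
  refine contDiffOn_infty.2 fun k => ?_
  induction k generalizing s j m with
  | zero =>
    refine contDiffOn_zero.2 fun p hp => ?_
    exact (hasFDerivAt_poissonHeatSeries hα hθ l c s j m hp.1).continuousAt.continuousWithinAt
  | succ k ih =>
    push_cast
    have hO : IsOpen (Set.Ioi (0 : ℝ) ×ˢ (Set.univ : Set ℝ)) := isOpen_Ioi.prod isOpen_univ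
    rw [contDiffOn_succ_iff_fderiv_of_isOpen hO]
    refine ⟨fun p hp => (hasFDerivAt_poissonHeatSeries hα hθ l c s j m
      hp.1).differentiableAt.differentiableWithinAt, by simp, ?_⟩
    refine ContDiffOn.congr ?_ fun p hp => (hasFDerivAt_poissonHeatSeries hα hθ l c s j m hp.1).fderiv
    have h := @ih
    fun_prop (disch := assumption)

theorem integrable_gaussian_density {θ : ℝ} (hθ : 0 < θ) :
    Integrable fun z : ℝ => (√(2 * π * θ))⁻¹ * Real.exp (-z ^ 2 / (2 * θ)) := by
  refine ((integrable_exp_neg_mul_sq (b := (2 * θ)⁻¹) (by positivity)).const_mul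
    (√(2 * π * θ))⁻¹).congr ?_
  refine Filter.Eventually.of_forall fun z => ?_
  simp only
  congr 2
  ring

theorem integral_gaussian_density {θ : ℝ} (hθ : 0 < θ) :
    ∫ z : ℝ, (√(2 * π * θ))⁻¹ * Real.exp (-z ^ 2 / (2 * θ)) = 1 := by
  have e : ∀ z : ℝ, Real.exp (-z ^ 2 / (2 * θ)) = Real.exp (-(2 * θ)⁻¹ * z ^ 2) := fun z => by
    congr 1
    ring
  simp_rw [e]
  rw [integral_const_mul, integral_gaussian, div_inv_eq_mul, ← mul_assoc, mul_comm π 2,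
    inv_mul_cancel₀ (by positivity)]

theorem integral_heatMonomial_add_mul_gaussian {v θ : ℝ} (hv : 0 < v) (hθ : 0 < θ) (y : ℝ) :
    ∫ z : ℝ, heatMonomial 0 0 v (y + z) * ((√(2 * π * θ))⁻¹ * Real.exp (-z ^ 2 / (2 * θ))) =
      heatMonomial 0 0 (v + θ) y := by
  have e : ∀ z : ℝ, heatMonomial 0 0 v (y + z) *
      ((√(2 * π * θ))⁻¹ * Real.exp (-z ^ 2 / (2 * θ))) =
      (√v)⁻¹ * (√(2 * π * θ))⁻¹ * Real.exp (-y ^ 2 / (2 * (v + θ))) *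
        Real.exp (-((v + θ) / (2 * v * θ)) * (z + y * θ / (v + θ)) ^ 2) := fun z => by
    have h : Real.exp (-(y + z) ^ 2 / (2 * v)) * Real.exp (-z ^ 2 / (2 * θ)) =
        Real.exp (-y ^ 2 / (2 * (v + θ))) *
          Real.exp (-((v + θ) / (2 * v * θ)) * (z + y * θ / (v + θ)) ^ 2) := by
      rw [← Real.exp_add, ← Real.exp_add]
      congr 1
      field_simp
      ring
    simp only [heatMonomial, pow_zero, mul_one]
    linear_combination (√v)⁻¹ * (√(2 * π * θ))⁻¹ * h
  simp_rw [e]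
  rw [integral_const_mul,
    integral_add_right_eq_self (fun z => Real.exp (-((v + θ) / (2 * v * θ)) * z ^ 2)),
    integral_gaussian]
  have h : π / ((v + θ) / (2 * v * θ)) = v * (2 * π * θ) / (v + θ) := by
    field_simp
  rw [h, Real.sqrt_div (by positivity), Real.sqrt_mul hv.le]
  simp only [heatMonomial, pow_zero, mul_one]
  field_simp

theorem poissonHeatTerm_one_succ (α θ l c : ℝ) (n : ℕ) (p : ℝ × ℝ) :
    poissonHeatTerm α θ l c 1 0 0 (n + 1) p = l * (poissonWeight l 0 n p.1 *
      heatMonomial 0 0 (α * p.1 + n * θ + θ) (p.2 - c * p.1)) := by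
  have e : α * p.1 + ((n + 1 : ℕ) : ℝ) * θ = α * p.1 + n * θ + θ := by
    push_cast
    ring
  simp only [poissonHeatTerm, poissonWeight, e, Nat.descFactorial_one, Nat.descFactorial_zero,
    Nat.factorial_succ, Nat.add_sub_cancel, Nat.sub_zero]
  push_cast
  field_simp
  ring

theorem integral_poissonHeatSeries_jump {α θ l : ℝ} (hα : 0 < α) (hθ : 0 < θ) (c : ℝ)
    {t : ℝ} (ht : 0 < t) (x : ℝ) :
    l * ∫ z : ℝ, (poissonHeatSeries α θ l c 0 0 0 (t, x + z)
        - poissonHeatSeries α θ l c 0 0 0 (t, x)) *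
          ((√(2 * π * θ))⁻¹ * Real.exp (-z ^ 2 / (2 * θ))) =
      poissonHeatSeries α θ l c 1 0 0 (t, x) - l * poissonHeatSeries α θ l c 0 0 0 (t, x) := by
  set g : ℝ → ℝ := fun z => (√(2 * π * θ))⁻¹ * Real.exp (-z ^ 2 / (2 * θ))
  have hg0 : ∀ z, 0 ≤ g z := fun z => by positivity
  have hgi : Integrable g := integrable_gaussian_density hθ
  have hv : ∀ n : ℕ, 0 < α * t + n * θ := fun n => by positivity
  set T : ℕ → ℝ → ℝ := fun n w => poissonHeatTerm α θ l c 0 0 0 n (t, w) with hT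
  have hS : ∀ w, HasSum (fun n => T n w) (poissonHeatSeries α θ l c 0 0 0 (t, w)) := fun w =>
    hasSum_poissonHeatSeries hα hθ l c 0 0 0 (p := (t, w)) ht
  let M : ℕ → ℝ := fun n => |poissonWeight l 0 n t| * (√(α * t))⁻¹
  have hM : Summable M := by
    refine Summable.mul_right _ (Summable.of_nonneg_of_le (fun n => abs_nonneg _)
      (fun n => abs_poissonWeight_le l 0 n (b := max 1 |t|) (le_max_left _ _) (le_max_right _ _))
      ((Real.summable_pow_div_factorial _).mul_left _))
  have hTM : ∀ n w, |T n w| ≤ M n := fun n w => by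
    have h := abs_heatMonomial_le 0 0 (a := α * t) (v := α * t + n * θ) (y := w - c * t)
      (by positivity) (le_add_of_nonneg_right (by positivity)) le_rfl
    rw [pow_zero, pow_zero, mul_one, mul_one] at h
    simp only [hT, poissonHeatTerm, abs_mul]
    exact mul_le_mul_of_nonneg_left h (abs_nonneg _)
  have hTc : ∀ n, Continuous (T n) := fun n => by
    simp only [hT, poissonHeatTerm, heatMonomial]
    fun_prop
  have hTi : ∀ n, Integrable fun z => T n (x + z) * g z := fun n =>
    hgi.bdd_mul (c := M n) ((hTc n).comp (continuous_const.add continuous_id)).aestronglyMeasurable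
      (Filter.Eventually.of_forall fun z => hTM n _)
  have hFi : ∀ n, Integrable fun z => (T n (x + z) - T n x) * g z := fun n => by
    simp_rw [sub_mul]
    exact (hTi n).sub (hgi.const_mul _)
  have hFn : ∀ n z, ‖(T n (x + z) - T n x) * g z‖ ≤ 2 * M n * g z := fun n z => by
    rw [norm_mul, Real.norm_of_nonneg (hg0 z), two_mul]
    exact mul_le_mul_of_nonneg_right ((norm_sub_le _ _).trans (add_le_add (hTM n _) (hTM n _)))
      (hg0 z)
  have hsum : Summable fun n => ∫ z, ‖(T n (x + z) - T n x) * g z‖ := by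
    refine Summable.of_nonneg_of_le (fun n => integral_nonneg fun z => norm_nonneg _)
      (fun n => ?_) (hM.mul_left 2)
    refine (integral_mono (hFi n).norm (hgi.const_mul _) (hFn n)).trans_eq ?_
    rw [integral_const_mul, integral_gaussian_density hθ, mul_one]
  have h1 := (hasSum_integral_of_summable_integral_norm hFi hsum).mul_left l
  have hF : ∀ z, ∑' n, (T n (x + z) - T n x) * g z =
      (poissonHeatSeries α θ l c 0 0 0 (t, x + z) - poissonHeatSeries α θ l c 0 0 0 (t, x)) * g z :=
    fun z => (((hS (x + z)).sub (hS x)).mul_right _).tsum_eq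
  simp_rw [hF] at h1
  have hInt : ∀ n, l * ∫ z, (T n (x + z) - T n x) * g z =
      poissonHeatTerm α θ l c 1 0 0 (n + 1) (t, x) - l * T n x := fun n => by
    have e : ∀ z, T n (x + z) * g z = poissonWeight l 0 n t *
        (heatMonomial 0 0 (α * t + n * θ) (x - c * t + z) * g z) := fun z => by
      simp only [hT, poissonHeatTerm]
      rw [show x + z - c * t = x - c * t + z by ring]
      ring
    have hI := integral_sub (hTi n) (hgi.const_mul (T n x))
    simp_rw [sub_mul]
    rw [hI, integral_const_mul, integral_gaussian_density hθ, poissonHeatTerm_one_succ]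
    simp_rw [e]
    rw [integral_const_mul, integral_heatMonomial_add_mul_gaussian (hv n) hθ]
    ring
  simp_rw [hInt] at h1
  have h2 := (hasSum_nat_add_iff' 1).2
    (hasSum_poissonHeatSeries hα hθ l c 1 0 0 (p := (t, x)) ht)
  have h0 : poissonHeatTerm α θ l c 1 0 0 0 (t, x) = 0 := by
    simp [poissonHeatTerm, poissonWeight]
  rw [Finset.sum_range_one, h0, sub_zero] at h2
  exact h1.unique (h2.sub ((hS x).mul_left l))

theorem G_eq_poissonHeatSeries (α θ l t x : ℝ) :
    G α θ l t x = (√(2 * π))⁻¹ * (Real.exp (-(l * t)) *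
      poissonHeatSeries α θ l (α / 2 + l * (Real.exp (θ / 2) - 1)) 0 0 0 (t, x)) := by
  rw [mul_left_comm, G, poissonHeatSeries]
  congr 1
  rw [← tsum_mul_left]
  refine tsum_congr fun n => ?_
  simp only [Gn, poissonHeatTerm, poissonWeight, heatMonomial,
    Real.sqrt_mul (by positivity : (0 : ℝ) ≤ 2 * π), mul_inv, mul_pow, Nat.descFactorial_zero,
    Nat.cast_one, Nat.sub_zero, pow_zero]
  ring

/-- `Γ^{α,θ,ℓ}` is smooth on `(0,∞) × ℝ` and solves the Kolmogorov equation of the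
constant-coefficient jump-diffusion operator `L^{α,θ,ℓ}`. -/
theorem stmt8 (α θ l : ℝ) (hα : 0 < α) (hθ : 0 < θ) (hl : 0 ≤ l) :
    ContDiffOn ℝ (⊤ : ℕ∞) (fun p : ℝ × ℝ => G α θ l p.1 p.2)
      (Set.Ioi (0 : ℝ) ×ˢ (Set.univ : Set ℝ)) ∧
    ∀ t : ℝ, 0 < t → ∀ x : ℝ,
      deriv (fun s => G α θ l s x) t =
        α / 2 * (deriv (deriv (fun w => G α θ l t w)) x - deriv (fun w => G α θ l t w) x)
          - l * (Real.exp (θ / 2) - 1) * deriv (fun w => G α θ l t w) x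
          + l * ∫ z : ℝ, (G α θ l t (x + z) - G α θ l t x) *
              ((Real.sqrt (2 * Real.pi * θ))⁻¹ * Real.exp (-z ^ 2 / (2 * θ))) := by
  simp_rw [G_eq_poissonHeatSeries]
  set c := α / 2 + l * (Real.exp (θ / 2) - 1) with hc
  refine ⟨?_, fun t ht x => ?_⟩
  · have h := contDiffOn_poissonHeatSeries hα hθ l c 0 0 0
    fun_prop
  let U := poissonHeatSeries α θ l c
  have hD := fun s j m w => hasFDerivAt_poissonHeatSeries hα hθ l c s j m (p := (t, w)) ht
  have hx : ∀ s j m w, HasDerivAt (fun w => U s j m (t, w))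
      (j * U s (j - 1) m (t, w) - U s (j + 1) (m + 1) (t, w)) w := fun s j m w => by
    refine ((hD s j m w).comp_hasDerivAt w
      ((hasDerivAt_const w t).prodMk (hasDerivAt_id w))).congr_deriv ?_
    simp [U]
  have ht' : HasDerivAt (fun r => U 0 0 0 (r, x))
      (U 1 0 0 (t, x) + α * (-(1 / 2) * U 0 0 1 (t, x) + 1 / 2 * U 0 2 2 (t, x))
        + c * U 0 1 1 (t, x)) t := by
    refine ((hD 0 0 0 x).comp_hasDerivAt t
      ((hasDerivAt_id t).prodMk (hasDerivAt_const t x))).congr_deriv ?_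
    simp [U]
  have hE : HasDerivAt (fun r => Real.exp (-(l * r))) (Real.exp (-(l * t)) * -(l * 1)) t :=
    ((hasDerivAt_id t).const_mul l).neg.exp
  have hdt := ((hE.mul ht').const_mul (√(2 * π))⁻¹).deriv
  have hdx : deriv (fun w => (√(2 * π))⁻¹ * (Real.exp (-(l * t)) * U 0 0 0 (t, w))) =
      fun w => (√(2 * π))⁻¹ * (Real.exp (-(l * t)) * -U 0 1 1 (t, w)) := by
    ext w
    rw [(((hx 0 0 0 w).const_mul _).const_mul _).deriv]
    simp
  have hdxx := (((hx 0 1 1 x).neg.const_mul (Real.exp (-(l * t)))).const_mul (√(2 * π))⁻¹).deriv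
  have hJ := integral_poissonHeatSeries_jump (l := l) hα hθ c ht x
  have e : ∀ z, ((√(2 * π))⁻¹ * (Real.exp (-(l * t)) * U 0 0 0 (t, x + z)) -
      (√(2 * π))⁻¹ * (Real.exp (-(l * t)) * U 0 0 0 (t, x))) *
        ((√(2 * π * θ))⁻¹ * Real.exp (-z ^ 2 / (2 * θ))) =
      (√(2 * π))⁻¹ * Real.exp (-(l * t)) * ((U 0 0 0 (t, x + z) - U 0 0 0 (t, x)) *
        ((√(2 * π * θ))⁻¹ * Real.exp (-z ^ 2 / (2 * θ)))) := fun z => by ring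
  change deriv (fun r => (√(2 * π))⁻¹ * (Real.exp (-(l * r)) * U 0 0 0 (r, x))) t = _ at hdt
  change deriv (fun w => (√(2 * π))⁻¹ * (Real.exp (-(l * t)) * -U 0 1 1 (t, w))) x = _ at hdxx
  change deriv (fun r => (√(2 * π))⁻¹ * (Real.exp (-(l * r)) * U 0 0 0 (r, x))) t = α / 2 *
    (deriv (deriv (fun w => (√(2 * π))⁻¹ * (Real.exp (-(l * t)) * U 0 0 0 (t, w)))) x
      - deriv (fun w => (√(2 * π))⁻¹ * (Real.exp (-(l * t)) * U 0 0 0 (t, w))) x)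
    - l * (Real.exp (θ / 2) - 1) *
      deriv (fun w => (√(2 * π))⁻¹ * (Real.exp (-(l * t)) * U 0 0 0 (t, w))) x
    + l * ∫ z : ℝ, ((√(2 * π))⁻¹ * (Real.exp (-(l * t)) * U 0 0 0 (t, x + z)) -
      (√(2 * π))⁻¹ * (Real.exp (-(l * t)) * U 0 0 0 (t, x))) *
        ((√(2 * π * θ))⁻¹ * Real.exp (-z ^ 2 / (2 * θ)))
  simp_rw [e]
  rw [integral_const_mul, hdt, hdx, hdxx]
  simp only [Nat.cast_one, one_mul, Nat.sub_self, Nat.reduceAdd]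
  linear_combination (-(√(2 * π))⁻¹ * Real.exp (-(l * t))) * hJ
    + (√(2 * π))⁻¹ * Real.exp (-(l * t)) * U 0 1 1 (t, x) * hc
end
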